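/- Global exponential stability of an ordinary follower's errors when its three out-neighbors are stationary at their desired distances: let pi, pj, pk ∈ ℝ³ be constant with ‖pji‖ = dji > 0, ‖pki‖ = dki, ‖pkj‖ = dkj, where pab := pb − pa, and with n := pki × pkj ≠ 0. Let pl : ℝ → ℝ³ be differentiable, let μ, ν, λ > 0 and ζ*, φ*, ϑ* ∈ ℝ, define pli(t) := pi − pl(t), plj(t) := pj − pl(t), and the errors ζ̃ = ⟨pli, pji⟩ − ζ*, φ̃ = ⟨pli, n × pji⟩ − φ*, ϑ̃ = ⟨pli, n⟩ − ϑ*, and suppose pl' = μ·ζ̃·(pli − plj) + ν·φ̃·(n × (pli − plj)) + λ·ϑ̃·n for all t ≥ 0 (note pli − plj = pji). Then W := (1/2)(ζ̃² + φ̃² + ϑ̃²) satisfies W'(t) = −μ·dji²·ζ̃(t)² − ν·‖n × pji‖²·φ̃(t)² − λ·‖n‖²·ϑ̃(t)², and since ‖n × pji‖ = ‖n‖·dji > 0 is a positive constant, W(t) ≤ W(0)·exp(−2·c·t) for some constant c > 0; hence (ζ̃, φ̃, ϑ̃) converges exponentially to (0,0,0). -/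

import Mathlib

open scoped RealInnerProductSpace
open Real Filter

noncomputable section

/-- Euclidean 3-space. -/
abbrev E3 : Type := EuclideanSpace ℝ (Fin 3)

/-- The cross product on `ℝ³`. -/
def cross3 (a b : E3) : E3 :=
  (WithLp.equiv 2 (Fin 3 → ℝ)).symm
    ![a 1 * b 2 - a 2 * b 1, a 2 * b 0 - a 0 * b 2, a 0 * b 1 - a 1 * b 0]

/-- The signed volume of the tetrahedron spanned by four points of `ℝ³`. -/
def signedVol (p1 p2 p3 p4 : E3) : ℝ :=
  -(1/6) * ⟪p1 - p4, cross3 (p2 - p4) (p3 - p4)⟫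

/-- The affine map `x ↦ R·x + d` on `ℝ³`. -/
def rigid (R : Matrix (Fin 3) (Fin 3) ℝ) (d : E3) (x : E3) : E3 :=
  (WithLp.equiv 2 (Fin 3 → ℝ)).symm (R.mulVec ((WithLp.equiv 2 (Fin 3 → ℝ)) x)) + d

/-- Projection error `ζ̃ = ⟨pli, pji⟩ − ζ*` of an ordinary follower. -/
def zetaErr (pi pj : E3) (pl : ℝ → E3) (ζs t : ℝ) : ℝ :=
  ⟪pi - pl t, pi - pj⟫ - ζs

/-- Projection error `φ̃ = ⟨pli, n × pji⟩ − φ*` of an ordinary follower. -/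
def phiErr (pi pj n : E3) (pl : ℝ → E3) (φs t : ℝ) : ℝ :=
  ⟪pi - pl t, cross3 n (pi - pj)⟫ - φs

/-- Projection error `ϑ̃ = ⟨pli, n⟩ − ϑ*` of an ordinary follower. -/
def varthetaErr (pi n : E3) (pl : ℝ → E3) (ϑs t : ℝ) : ℝ :=
  ⟪pi - pl t, n⟫ - ϑs

/-- Lyapunov function `W = (1/2)(ζ̃² + φ̃² + ϑ̃²)`. -/
def Wl (pi pj n : E3) (pl : ℝ → E3) (ζs φs ϑs t : ℝ) : ℝ :=
  (1/2) * (zetaErr pi pj pl ζs t ^ 2 + phiErr pi pj n pl φs t ^ 2 +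
    varthetaErr pi n pl ϑs t ^ 2)

theorem inner_eq_sum_coords (a b : E3) : ⟪a, b⟫ = a 0 * b 0 + a 1 * b 1 + a 2 * b 2 := by
  simp [PiLp.inner_apply, Fin.sum_univ_three, mul_comm]

@[simp] theorem cross3_apply_zero (a b : E3) : cross3 a b 0 = a 1 * b 2 - a 2 * b 1 := rfl

@[simp] theorem cross3_apply_one (a b : E3) : cross3 a b 1 = a 2 * b 0 - a 0 * b 2 := rfl

@[simp] theorem cross3_apply_two (a b : E3) : cross3 a b 2 = a 0 * b 1 - a 1 * b 0 := rfl

theorem inner_cross3_self_left (a b : E3) : ⟪a, cross3 a b⟫ = 0 := by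
  simp only [inner_eq_sum_coords, cross3_apply_zero, cross3_apply_one, cross3_apply_two]
  ring

theorem inner_cross3_self_right (a b : E3) : ⟪b, cross3 a b⟫ = 0 := by
  simp only [inner_eq_sum_coords, cross3_apply_zero, cross3_apply_one, cross3_apply_two]
  ring

/-- Lagrange's identity. -/
theorem norm_cross3_sq (a b : E3) :
    ‖cross3 a b‖ ^ 2 = ‖a‖ ^ 2 * ‖b‖ ^ 2 - ⟪a, b⟫ ^ 2 := by
  simp only [← real_inner_self_eq_norm_sq, inner_eq_sum_coords, cross3_apply_zero,
    cross3_apply_one, cross3_apply_two]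
  ring

theorem norm_cross3_of_inner_eq_zero {a b : E3} (h : ⟪a, b⟫ = 0) :
    ‖cross3 a b‖ = ‖a‖ * ‖b‖ := by
  rw [← sq_eq_sq₀ (norm_nonneg _) (by positivity), norm_cross3_sq, h]
  ring

theorem le_mul_exp_of_hasDerivAt_le {f f' : ℝ → ℝ} {k : ℝ}
    (hf : ∀ t, 0 ≤ t → HasDerivAt f (f' t) t) (hle : ∀ t, 0 ≤ t → f' t ≤ k * f t)
    {t : ℝ} (ht : 0 ≤ t) : f t ≤ f 0 * Real.exp (k * t) := by
  have hg : ∀ s, 0 ≤ s → HasDerivAt (fun s => f s * Real.exp (-(k * s)))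
      ((f' s - k * f s) * Real.exp (-(k * s))) s := by
    intro s hs
    have he : HasDerivAt (fun s => Real.exp (-(k * s))) (Real.exp (-(k * s)) * -(k * 1)) s :=
      ((hasDerivAt_id s).const_mul k).neg.exp
    refine ((hf s hs).mul he).congr_deriv ?_
    ring
  have hanti : AntitoneOn (fun s => f s * Real.exp (-(k * s))) (Set.Ici 0) := by
    refine antitoneOn_of_deriv_nonpos (convex_Ici 0)
      (fun s hs => (hg s hs).continuousAt.continuousWithinAt) ?_ ?_ <;>
      rw [interior_Ici] <;> intro s hs
    · exact (hg s (le_of_lt hs)).differentiableAt.differentiableWithinAt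
    · rw [(hg s (le_of_lt hs)).deriv]
      exact mul_nonpos_of_nonpos_of_nonneg (sub_nonpos.2 (hle s (le_of_lt hs)))
        (Real.exp_pos _).le
  have h := hanti Set.self_mem_Ici ht ht
  simp only [mul_zero, neg_zero, Real.exp_zero, mul_one, Real.exp_neg] at h
  rwa [← div_eq_mul_inv, div_le_iff₀ (Real.exp_pos _)] at h

theorem hasDerivAt_inner_const_sub {p : ℝ → E3} {p' : E3} {t : ℝ} (hp : HasDerivAt p p' t)
    (q v : E3) (s : ℝ) : HasDerivAt (fun t => ⟪q - p t, v⟫ - s) (-⟪p', v⟫) t := by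
  simpa using ((hp.const_sub q).inner ℝ (hasDerivAt_const t v)).sub_const s

theorem hasDerivAt_Wl {pi pj n : E3} {pl : ℝ → E3} {μ ν lam ζs φs ϑs t : ℝ}
    (hn : ⟪n, pi - pj⟫ = 0)
    (hl : HasDerivAt pl
      ((μ * zetaErr pi pj pl ζs t) • (pi - pj) +
        (ν * phiErr pi pj n pl φs t) • cross3 n (pi - pj) +
        (lam * varthetaErr pi n pl ϑs t) • n) t) :
    HasDerivAt (Wl pi pj n pl ζs φs ϑs)
      (-(μ * ‖pi - pj‖ ^ 2 * zetaErr pi pj pl ζs t ^ 2) -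
        ν * ‖cross3 n (pi - pj)‖ ^ 2 * phiErr pi pj n pl φs t ^ 2 -
        lam * ‖n‖ ^ 2 * varthetaErr pi n pl ϑs t ^ 2) t := by
  have hn' : ⟪pi - pj, n⟫ = 0 := by rw [real_inner_comm, hn]
  have hnc := inner_cross3_self_left n (pi - pj)
  have hec := inner_cross3_self_right n (pi - pj)
  have hcn : ⟪cross3 n (pi - pj), n⟫ = 0 := by rw [real_inner_comm, hnc]
  have hce : ⟪cross3 n (pi - pj), pi - pj⟫ = 0 := by rw [real_inner_comm, hec]
  have hζ : HasDerivAt (zetaErr pi pj pl ζs) _ t :=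
    hasDerivAt_inner_const_sub hl pi (pi - pj) ζs
  have hφ : HasDerivAt (phiErr pi pj n pl φs) _ t :=
    hasDerivAt_inner_const_sub hl pi (cross3 n (pi - pj)) φs
  have hϑ : HasDerivAt (varthetaErr pi n pl ϑs) _ t :=
    hasDerivAt_inner_const_sub hl pi n ϑs
  have hW : HasDerivAt (Wl pi pj n pl ζs φs ϑs) _ t :=
    (((hζ.pow 2).add (hφ.pow 2)).add (hϑ.pow 2)).const_mul (1 / 2)
  convert hW using 1
  simp only [inner_add_left, real_inner_smul_left, hn, hn', hnc, hec, hcn, hce,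
    real_inner_self_eq_norm_sq]
  norm_num
  ring

/-- Global exponential stability of an ordinary follower's errors when
its three out-neighbors are stationary at their desired distances. -/
theorem ordinary_follower_GES
    (pi pj pk : E3) (pl : ℝ → E3) (dji dki dkj μ ν lam ζs φs ϑs : ℝ)
    (hdji : 0 < dji) (hji : ‖pi - pj‖ = dji) (hki : ‖pi - pk‖ = dki)
    (hkj : ‖pj - pk‖ = dkj)
    (hn : cross3 (pi - pk) (pj - pk) ≠ 0)
    (hμ : 0 < μ) (hν : 0 < ν) (hlam : 0 < lam)
    (hl : ∀ t : ℝ, 0 ≤ t → HasDerivAt pl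
      ((μ * zetaErr pi pj pl ζs t) • ((pi - pl t) - (pj - pl t)) +
        (ν * phiErr pi pj (cross3 (pi - pk) (pj - pk)) pl φs t) •
          cross3 (cross3 (pi - pk) (pj - pk)) ((pi - pl t) - (pj - pl t)) +
        (lam * varthetaErr pi (cross3 (pi - pk) (pj - pk)) pl ϑs t) •
          cross3 (pi - pk) (pj - pk)) t) :
    (∀ t : ℝ, 0 ≤ t → HasDerivAt
        (Wl pi pj (cross3 (pi - pk) (pj - pk)) pl ζs φs ϑs)
        (-(μ * dji ^ 2 * zetaErr pi pj pl ζs t ^ 2) -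
          ν * ‖cross3 (cross3 (pi - pk) (pj - pk)) (pi - pj)‖ ^ 2 *
            phiErr pi pj (cross3 (pi - pk) (pj - pk)) pl φs t ^ 2 -
          lam * ‖cross3 (pi - pk) (pj - pk)‖ ^ 2 *
            varthetaErr pi (cross3 (pi - pk) (pj - pk)) pl ϑs t ^ 2) t) ∧
      ‖cross3 (cross3 (pi - pk) (pj - pk)) (pi - pj)‖ =
        ‖cross3 (pi - pk) (pj - pk)‖ * dji ∧
      ∃ c : ℝ, 0 < c ∧ ∀ t : ℝ, 0 ≤ t →
        Wl pi pj (cross3 (pi - pk) (pj - pk)) pl ζs φs ϑs t ≤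
          Wl pi pj (cross3 (pi - pk) (pj - pk)) pl ζs φs ϑs 0 *
            Real.exp (-2 * c * t) := by
  have hne : ⟪cross3 (pi - pk) (pj - pk), pi - pj⟫ = 0 := by
    rw [real_inner_comm, ← sub_sub_sub_cancel_right pi pj pk, inner_sub_left,
      inner_cross3_self_left, inner_cross3_self_right, sub_zero]
  simp only [sub_sub_sub_cancel_right] at hl
  generalize cross3 (pi - pk) (pj - pk) = n at *
  subst hji
  have hderiv := fun t ht => hasDerivAt_Wl hne (hl t ht)
  have hnorm := norm_cross3_of_inner_eq_zero hne
  have hn0 : 0 < ‖n‖ := norm_pos_iff.2 hn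
  refine ⟨hderiv, hnorm, min (μ * ‖pi - pj‖ ^ 2)
    (min (ν * ‖cross3 n (pi - pj)‖ ^ 2) (lam * ‖n‖ ^ 2)), ?_, fun t ht =>
    le_mul_exp_of_hasDerivAt_le hderiv (fun s _ => ?_) ht⟩
  · rw [hnorm]
    positivity
  · set a := μ * ‖pi - pj‖ ^ 2
    set b := ν * ‖cross3 n (pi - pj)‖ ^ 2
    set d := lam * ‖n‖ ^ 2
    have ha : min a (min b d) ≤ a := min_le_left _ _
    have hb : min a (min b d) ≤ b := (min_le_right _ _).trans (min_le_left _ _)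
    have hd : min a (min b d) ≤ d := (min_le_right _ _).trans (min_le_right _ _)
    have hζ := mul_le_mul_of_nonneg_right ha (sq_nonneg (zetaErr pi pj pl ζs s))
    have hφ := mul_le_mul_of_nonneg_right hb (sq_nonneg (phiErr pi pj n pl φs s))
    have hϑ := mul_le_mul_of_nonneg_right hd (sq_nonneg (varthetaErr pi n pl ϑs s))
    unfold Wl
    linarith
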